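/- Let n be a positive even integer, let (B,d) be a metric space of finite generalized roundness 𝔮(B), and let f : M_{n+2} → B be any function. Then for every real p with 0 ≤ p ≤ 𝔮(B) and every integer t with −n ≤ t ≤ 0, one has (1/N_{(t,n+1)}) · Σ_{{x,y}∈Θ_t^{n+1}} d(f(x),f(y))^p ≥ (1 − 1/(n+2))^n · (1/N_{(t+n,1)}) · Σ_{{u,v}∈Θ_{t+n}^1} d(f(u),f(v))^p, where the (t,m)-pairs are taken in M_{n+2} and N_{(t,m)} denotes their number. If 𝔮(B) = ∞, the same inequality holds for all p ≥ 0 and all −n ≤ t ≤ 0. -/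

import Mathlib

/-!
Theorem 1 of the paper: the recursive averaging inequality in `M_{n+2}` for functions
into a metric space `B` whose generalized roundness is at least `p`.

The generalized roundness `𝔮(B)` is valued in `ℝ≥0∞`; the hypothesis
`ENNReal.ofReal p ≤ genRoundness dist` covers both the case `0 ≤ p ≤ 𝔮(B) < ∞` and the
case `𝔮(B) = ∞` with arbitrary `p ≥ 0`.  Sums and counts are taken over ordered
`(t,m)`-pairs; since every unordered pair then appears exactly twice in both the count
and the sum, the normalized averages agree with those over unordered pairs.
-/

/-- The cyclic metric with period `n^n`. -/
noncomputable def cyclicDist (n : ℕ) (a b : ℝ) : ℝ :=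
  min |a - b| ((n : ℝ) ^ n - |a - b|)

/-- The set `L_n = {k·n^{-n} : 1 ≤ k ≤ n^{2n}}`. -/
def Ln (n : ℕ) : Set ℝ :=
  {a | ∃ k : ℕ, 1 ≤ k ∧ k ≤ n ^ (2 * n) ∧ a = (k : ℝ) / (n : ℝ) ^ n}

/-- The set `M_n`, the product of `n^n` copies of `L_n`. -/
def Mn (n : ℕ) : Set (Fin (n ^ n) → ℝ) := {x | ∀ i, x i ∈ Ln n}

/-- `{x, y}` is a `(t,m)`-pair in `M_n`. -/
def IsPair (n : ℕ) (t : ℤ) (m : ℕ) (x y : Fin (n ^ n) → ℝ) : Prop :=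
  x ∈ Mn n ∧ y ∈ Mn n ∧
    (∀ i, x i ≠ y i → cyclicDist n (x i) (y i) = (2 : ℝ) ^ t) ∧
    Set.ncard {i | x i ≠ y i} = n ^ m

/-- The set `Θ_t^m` of (ordered) `(t,m)`-pairs in `M_n`. -/
def pairSet (n : ℕ) (t : ℤ) (m : ℕ) : Set ((Fin (n ^ n) → ℝ) × (Fin (n ^ n) → ℝ)) :=
  {q | IsPair n t m q.1 q.2}

/-- `N_{(t,m)}`: the number of (ordered) `(t,m)`-pairs in `M_n`. -/
noncomputable def pairCount (n : ℕ) (t : ℤ) (m : ℕ) : ℕ :=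
  Set.ncard (pairSet n t m)

/-- The set of exponents `p ≥ 0` for which the generalized roundness inequality holds in
the space with distance function `d`. -/
def grSet {X : Type*} (d : X → X → ℝ) : Set ℝ :=
  {p | 0 ≤ p ∧ ∀ n : ℕ, 2 ≤ n → ∀ x y : Fin n → X,
    (∑ i, ∑ j, if i < j then d (x i) (x j) ^ p + d (y i) (y j) ^ p else 0) ≤
      ∑ i, ∑ j, d (x i) (y j) ^ p}

/-- The generalized roundness `𝔮` of the space with distance function `d`,
valued in `ℝ≥0∞`. -/
noncomputable def genRoundness {X : Type*} (d : X → X → ℝ) : ENNReal :=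
  sSup (ENNReal.ofReal '' grSet d)

open Finset Filter Topology MeasureTheory in
/-- The entrywise exponential of a positive semidefinite kernel is positive semidefinite. -/
lemma sum_exp_nonneg_of_posSemidef {ι : Type*} [Fintype ι] {A : Matrix ι ι ℝ}
    (hA : A.PosSemidef) (c : ι → ℝ) :
    0 ≤ ∑ i, ∑ j, c i * c j * Real.exp (A i j) := by
  have hpow : ∀ k : ℕ, (Matrix.of fun i j => A i j ^ k).PosSemidef := by
    intro k
    induction k with
    | zero =>
      refine .of_dotProduct_mulVec_nonneg (by ext; simp) fun x => ?_
      have : star x ⬝ᵥ ((Matrix.of fun i j => A i j ^ 0).mulVec x) = (∑ i, x i) ^ 2 := by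
        simp [dotProduct, Matrix.mulVec, sq, sum_mul]
      rw [this]
      positivity
    | succ k ih =>
      have h : (Matrix.of fun i j => A i j ^ (k + 1)) =
          (Matrix.of fun i j => A i j ^ k).hadamard A := by
        ext i j
        simp [pow_succ]
      rw [h]
      exact ih.hadamard hA
  have hsum : HasSum (fun k : ℕ => ∑ i, ∑ j, c i * c j * (A i j ^ k / (k.factorial : ℝ)))
      (∑ i, ∑ j, c i * c j * Real.exp (A i j)) := by
    refine hasSum_sum fun i _ => hasSum_sum fun j _ => HasSum.mul_left _ ?_
    rw [Real.exp_eq_exp_ℝ]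
    exact NormedSpace.expSeries_div_hasSum_exp (A i j)
  refine hsum.nonneg fun k => ?_
  have h := (hpow k).dotProduct_mulVec_nonneg c
  have : ∑ i, ∑ j, c i * c j * (A i j ^ k / (k.factorial : ℝ)) =
      (star c ⬝ᵥ ((Matrix.of fun i j => A i j ^ k).mulVec c)) / (k.factorial : ℝ) := by
    simp only [dotProduct, Matrix.mulVec, Matrix.of_apply, sum_div, mul_sum, star_trivial]
    refine sum_congr rfl fun i _ => sum_congr rfl fun j _ => by ring
  rw [this]
  positivity

/-- A kernel on a finite set is of negative type if its quadratic form is nonpositive on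
vectors whose coordinates sum to zero. -/
def IsNegativeType {ι : Type*} [Fintype ι] (ψ : ι → ι → ℝ) : Prop :=
  ∀ c : ι → ℝ, ∑ i, c i = 0 → ∑ i, ∑ j, c i * c j * ψ i j ≤ 0

open Finset in
/-- One direction of Schoenberg's theorem: `exp (-u ψ)` is positive semidefinite. -/
lemma IsNegativeType.sum_exp_nonneg {ι : Type*} [Fintype ι] {ψ : ι → ι → ℝ}
    (hψ : IsNegativeType ψ) (hsymm : ∀ i j, ψ i j = ψ j i) {u : ℝ} (hu : 0 ≤ u) (c : ι → ℝ) :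
    0 ≤ ∑ i, ∑ j, c i * c j * Real.exp (-u * ψ i j) := by
  classical
  rcases isEmpty_or_nonempty ι with h | ⟨⟨o⟩⟩
  · simp
  let A : Matrix ι ι ℝ := Matrix.of fun i j => u * (ψ i o + ψ j o - ψ i j - ψ o o)
  have hA : A.PosSemidef := by
    refine .of_dotProduct_mulVec_nonneg ?_ fun x => ?_
    · ext i j
      simp only [A, Matrix.conjTranspose_apply, Matrix.of_apply, star_trivial, hsymm i j]
      ring
    · have h1 := hψ (fun i => x i - if i = o then ∑ k, x k else 0) (by simp)
      have h2 : ∑ i, ∑ j, (x i - if i = o then ∑ k, x k else 0) *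
          (x j - if j = o then ∑ k, x k else 0) * ψ i j =
          (∑ i, ∑ j, x i * x j * ψ i j) - 2 * ((∑ k, x k) * ∑ i, x i * ψ i o)
            + (∑ k, x k) ^ 2 * ψ o o := by
        have e1 : ∀ i, ∑ j, (x i - if i = o then ∑ k, x k else 0) *
            (x j - if j = o then ∑ k, x k else 0) * ψ i j =
            (x i - if i = o then ∑ k, x k else 0) *
              ((∑ j, x j * ψ i j) - (∑ k, x k) * ψ i o) := by
          intro i
          simp only [mul_assoc, ← mul_sum]
          simp [sub_mul, sum_sub_distrib]
        rw [sum_congr rfl fun i _ => e1 i]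
        simp only [sub_mul, sum_sub_distrib, ite_mul, zero_mul, sum_ite_eq', mem_univ,
          if_true, mul_sub]
        have e2 : ∑ j, x j * ψ o j = ∑ i, x i * ψ i o :=
          sum_congr rfl fun j _ => by rw [hsymm]
        have e3 : ∑ i, x i * ((∑ k, x k) * ψ i o) = (∑ k, x k) * ∑ i, x i * ψ i o := by
          rw [mul_sum]; exact sum_congr rfl fun j _ => by ring
        have e4 : ∑ i, x i * ∑ j, x j * ψ i j = ∑ i, ∑ j, x i * x j * ψ i j :=
          sum_congr rfl fun i _ => by simp only [mul_sum, mul_assoc]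
        rw [e2, e3, e4]
        ring
      have h3 : star x ⬝ᵥ A.mulVec x =
          u * (2 * ((∑ k, x k) * ∑ i, x i * ψ i o) - (∑ i, ∑ j, x i * x j * ψ i j)
            - (∑ k, x k) ^ 2 * ψ o o) := by
        have e1 : ∑ i, ∑ j, x i * x j * ψ i o = (∑ k, x k) * ∑ i, x i * ψ i o := by
          rw [sum_comm, sum_mul_sum]
          exact sum_congr rfl fun i _ => sum_congr rfl fun j _ => by ring
        have e2 : ∑ i, ∑ j, x i * x j * ψ j o = (∑ k, x k) * ∑ i, x i * ψ i o := by
          rw [sum_mul_sum]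
          exact sum_congr rfl fun i _ => sum_congr rfl fun j _ => by ring
        have e3 : ∑ i, ∑ j, x i * x j * ψ o o = (∑ k, x k) ^ 2 * ψ o o := by
          rw [sq, sum_mul_sum, sum_mul]
          exact sum_congr rfl fun i _ => by rw [sum_mul]
        have e4 : star x ⬝ᵥ A.mulVec x = ∑ i, ∑ j, u * (x i * x j * ψ i o + x i * x j * ψ j o
            - x i * x j * ψ i j - x i * x j * ψ o o) := by
          simp only [A, dotProduct, Matrix.mulVec, Matrix.of_apply, star_trivial, mul_sum]
          exact sum_congr rfl fun i _ => sum_congr rfl fun j _ => by ring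
        rw [e4]
        simp only [← mul_sum, sum_add_distrib, sum_sub_distrib, e1, e2, e3]
        ring
      rw [h3]
      refine mul_nonneg hu ?_
      linarith
  have h := sum_exp_nonneg_of_posSemidef hA fun i => c i * Real.exp (-u * ψ i o)
  have h' : ∑ i, ∑ j, c i * c j * Real.exp (-u * ψ i j) = Real.exp (u * ψ o o) *
      ∑ i, ∑ j, c i * Real.exp (-u * ψ i o) * (c j * Real.exp (-u * ψ j o)) *
        Real.exp (A i j) := by
    rw [mul_sum]
    refine sum_congr rfl fun i _ => ?_
    rw [mul_sum]
    refine sum_congr rfl fun j _ => ?_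
    have : Real.exp (-u * ψ i j) = Real.exp (u * ψ o o) * (Real.exp (-u * ψ i o) *
        (Real.exp (-u * ψ j o) * Real.exp (A i j))) := by
      simp only [← Real.exp_add, A, Matrix.of_apply]
      congr 1
      ring
    rw [this]
    ring
  rw [h']
  positivity

open Finset MeasureTheory Set in
lemma IsNegativeType.sum_inv_nonneg {ι : Type*} [Fintype ι] {ψ : ι → ι → ℝ}
    (hψ : IsNegativeType ψ) (hsymm : ∀ i j, ψ i j = ψ j i) (h0 : ∀ i j, 0 ≤ ψ i j)
    {t : ℝ} (ht : 0 < t) (c : ι → ℝ) :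
    0 ≤ ∑ i, ∑ j, c i * c j * (t + ψ i j)⁻¹ := by
  have hneg : ∀ i j, -(t + ψ i j) < 0 := fun i j => by linarith [h0 i j]
  have hint : ∀ i j, IntegrableOn (fun u => Real.exp (-(t + ψ i j) * u)) (Ioi 0) := fun i j =>
    integrableOn_exp_mul_Ioi (hneg i j) 0
  have hval : ∀ i j, (t + ψ i j)⁻¹ = ∫ u in Ioi (0 : ℝ), Real.exp (-(t + ψ i j) * u) := by
    intro i j
    rw [integral_exp_mul_Ioi (hneg i j), mul_zero, Real.exp_zero, neg_div_neg_eq, one_div]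
  have key : ∑ i, ∑ j, c i * c j * (t + ψ i j)⁻¹ = ∫ u in Ioi (0 : ℝ),
      ∑ i, ∑ j, c i * c j * Real.exp (-(t + ψ i j) * u) := by
    rw [integral_finsetSum _ fun i _ => integrable_finsetSum _ fun j _ => (hint i j).const_mul _]
    refine sum_congr rfl fun i _ => ?_
    rw [integral_finsetSum _ fun j _ => (hint i j).const_mul _]
    refine sum_congr rfl fun j _ => ?_
    rw [integral_const_mul, hval]
  rw [key]
  refine setIntegral_nonneg measurableSet_Ioi fun u hu => ?_
  have h := mul_nonneg (Real.exp_pos (-t * u)).le (hψ.sum_exp_nonneg hsymm (le_of_lt hu) c)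
  refine h.trans_eq ?_
  rw [mul_sum]
  refine sum_congr rfl fun i _ => ?_
  rw [mul_sum]
  refine sum_congr rfl fun j _ => ?_
  rw [mul_left_comm, ← Real.exp_add]
  congr 2
  ring

open Finset MeasureTheory Set in
/-- Powers with exponent in `(0, 1)` of a kernel of negative type are of negative type. -/
lemma IsNegativeType.rpow {ι : Type*} [Fintype ι] {ψ : ι → ι → ℝ}
    (hψ : IsNegativeType ψ) (hsymm : ∀ i j, ψ i j = ψ j i) (h0 : ∀ i j, 0 ≤ ψ i j)
    {α : ℝ} (hα : α ∈ Ioo (0 : ℝ) 1) : IsNegativeType fun i j => ψ i j ^ α := by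
  intro c hc
  have hint : ∀ i j, IntegrableOn (fun t => Real.rpowIntegrand₀₁ α t (ψ i j)) (Ioi 0) :=
    fun i j => Real.integrableOn_rpowIntegrand₀₁_Ioi hα (h0 i j)
  have hC : 0 ≤ (∫ t in Ioi 0, Real.rpowIntegrand₀₁ α t 1)⁻¹ :=
    (inv_pos.2 (Real.integral_rpowIntegrand₀₁_one_pos hα)).le
  have key : ∑ i, ∑ j, c i * c j * ψ i j ^ α =
      (∫ t in Ioi 0, Real.rpowIntegrand₀₁ α t 1)⁻¹ *
        ∫ t in Ioi (0 : ℝ), ∑ i, ∑ j, c i * c j * Real.rpowIntegrand₀₁ α t (ψ i j) := by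
    rw [integral_finsetSum _ fun i _ => integrable_finsetSum _ fun j _ => (hint i j).const_mul _,
      mul_sum]
    refine sum_congr rfl fun i _ => ?_
    rw [integral_finsetSum _ fun j _ => (hint i j).const_mul _, mul_sum]
    refine sum_congr rfl fun j _ => ?_
    rw [integral_const_mul, Real.rpow_eq_const_mul_integral hα (h0 i j)]
    ring
  change ∑ i, ∑ j, c i * c j * ψ i j ^ α ≤ 0
  rw [key]
  refine mul_nonpos_of_nonneg_of_nonpos hC (setIntegral_nonpos measurableSet_Ioi fun t ht => ?_)
  have ht' : (0 : ℝ) < t := ht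
  have h := hψ.sum_inv_nonneg hsymm h0 ht' c
  have e1 : ∑ i, ∑ j, c i * c j * t⁻¹ = 0 := by
    simp only [← sum_mul, ← sum_mul_sum, hc, zero_mul]
  have e2 : ∑ i, ∑ j, c i * c j * Real.rpowIntegrand₀₁ α t (ψ i j) =
      t ^ α * (∑ i, ∑ j, c i * c j * t⁻¹ - ∑ i, ∑ j, c i * c j * (t + ψ i j)⁻¹) := by
    simp only [Real.rpowIntegrand₀₁, mul_sub, mul_sum, ← sum_sub_distrib]
    exact sum_congr rfl fun i _ => sum_congr rfl fun j _ => by ring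
  rw [e2, e1, zero_sub, mul_neg]
  have := Real.rpow_nonneg ht'.le α
  have := mul_nonneg this h
  linarith

open Filter Topology in
lemma tendsto_floor_mul_div_atTop (a : ℝ) :
    Tendsto (fun k : ℕ => (⌊a * k⌋ : ℝ) / k) atTop (𝓝 a) := by
  have h : Tendsto (fun k : ℕ => a - 1 / (k : ℝ)) atTop (𝓝 a) := by
    simpa using tendsto_const_nhds.sub (tendsto_one_div_atTop_nhds_zero_nat (𝕜 := ℝ))
  refine tendsto_of_tendsto_of_tendsto_of_le_of_le' h tendsto_const_nhds ?_ ?_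
  all_goals
    filter_upwards [eventually_gt_atTop 0] with k hk
    have hk' : (0 : ℝ) < k := by exact_mod_cast hk
  · rw [le_div_iff₀ hk', sub_mul, one_div, inv_mul_cancel₀ hk'.ne']
    exact (Int.sub_one_lt_floor _).le
  · rw [div_le_iff₀ hk']
    exact Int.floor_le _

open Finset in
lemma sum_sum_eq_two_mul_sum_lt {n : ℕ} (g : Fin n → Fin n → ℝ) (hsymm : ∀ i j, g i j = g j i)
    (h0 : ∀ i, g i i = 0) :
    ∑ i, ∑ j, g i j = 2 * ∑ i, ∑ j, if i < j then g i j else 0 := by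
  have h1 : ∑ i, ∑ j, g i j =
      ∑ i, ∑ j, ((if i < j then g i j else 0) + if j < i then g j i else 0) := by
    refine sum_congr rfl fun i _ => sum_congr rfl fun j _ => ?_
    rcases lt_trichotomy i j with h | rfl | h
    · simp [h, h.not_gt]
    · simp [h0]
    · simp [h, h.not_gt, hsymm i j]
  simp only [h1, sum_add_distrib]
  rw [sum_comm (f := fun i j => if j < i then g j i else 0), two_mul]

open Finset in
lemma sum_lt_add_eq {X : Type*} [MetricSpace X] {p : ℝ} (hp : 0 < p) {n : ℕ} (x y : Fin n → X) :
    2 * (∑ i, ∑ j, if i < j then dist (x i) (x j) ^ p + dist (y i) (y j) ^ p else 0) =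
      ∑ i, ∑ j, dist (x i) (x j) ^ p + ∑ i, ∑ j, dist (y i) (y j) ^ p := by
  rw [← sum_sum_eq_two_mul_sum_lt (fun i j => dist (x i) (x j) ^ p + dist (y i) (y j) ^ p)
    (fun i j => by rw [dist_comm (x i), dist_comm (y i)])
    (fun i => by simp [Real.zero_rpow hp.ne'])]
  simp only [sum_add_distrib]

/-- For a positive exponent, the roundness inequality holds for families of every size. -/
lemma roundness_ineq {X : Type*} [MetricSpace X] {p : ℝ} (hp : 0 < p)
    (h : p ∈ grSet (dist : X → X → ℝ)) {α β : Type*} [Fintype α] [Fintype β]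
    (hcard : Fintype.card α = Fintype.card β) (x : α → X) (y : β → X) :
    ∑ i, ∑ j, dist (x i) (x j) ^ p + ∑ i, ∑ j, dist (y i) (y j) ^ p ≤
      2 * ∑ i, ∑ j, dist (x i) (y j) ^ p := by
  let e := (Fintype.equivFin α).symm
  let e' := (Fintype.equivFinOfCardEq hcard.symm).symm
  have key : ∑ i, ∑ j, dist (x (e i)) (x (e j)) ^ p + ∑ i, ∑ j, dist (y (e' i)) (y (e' j)) ^ p ≤
      2 * ∑ i, ∑ j, dist (x (e i)) (y (e' j)) ^ p := by
    rw [← sum_lt_add_eq hp (fun i => x (e i)) fun i => y (e' i)]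
    refine mul_le_mul_of_nonneg_left ?_ zero_le_two
    by_cases hn : 2 ≤ Fintype.card α
    · exact h.2 _ hn _ _
    · refine (Finset.sum_nonpos fun i _ => Finset.sum_nonpos fun j _ => ?_).trans
        (Finset.sum_nonneg fun i _ => Finset.sum_nonneg fun j _ => by positivity)
      rw [if_neg]
      have := i.2
      have := j.2
      omega
  have hx : ∀ g : α → α → ℝ, ∑ i, ∑ j, g (e i) (e j) = ∑ i, ∑ j, g i j := fun g => by
    rw [← Equiv.sum_comp e]
    exact Finset.sum_congr rfl fun i _ => Equiv.sum_comp e _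
  have hy : ∀ g : β → β → ℝ, ∑ i, ∑ j, g (e' i) (e' j) = ∑ i, ∑ j, g i j := fun g => by
    rw [← Equiv.sum_comp e']
    exact Finset.sum_congr rfl fun i _ => Equiv.sum_comp e' _
  have hxy : ∀ g : α → β → ℝ, ∑ i, ∑ j, g (e i) (e' j) = ∑ i, ∑ j, g i j := fun g => by
    rw [← Equiv.sum_comp e]
    exact Finset.sum_congr rfl fun i _ => Equiv.sum_comp e' _
  rwa [hx fun i j => dist (x i) (x j) ^ p, hy fun i j => dist (y i) (y j) ^ p,
    hxy fun i j => dist (x i) (y j) ^ p] at key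

open Finset in
lemma roundness_int {X : Type*} [MetricSpace X] {p : ℝ} (hp : 0 < p)
    (h : p ∈ grSet (dist : X → X → ℝ)) {ι : Type*} [Fintype ι] (z : ι → X) (c : ι → ℤ)
    (hc : ∑ i, c i = 0) :
    ∑ i, ∑ j, (c i : ℝ) * c j * dist (z i) (z j) ^ p ≤ 0 := by
  have hsub : ∀ i, ((c i).toNat : ℤ) - (-c i).toNat = c i := fun i => Int.toNat_sub_toNat_neg _
  have hcard : Fintype.card (Σ i, Fin (c i).toNat) = Fintype.card (Σ i, Fin (-c i).toNat) := by
    simp only [Fintype.card_sigma, Fintype.card_fin]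
    have : ∑ i, (((c i).toNat : ℤ) - (-c i).toNat) = 0 := by simpa only [hsub] using hc
    rw [sum_sub_distrib, sub_eq_zero] at this
    exact_mod_cast this
  have key := roundness_ineq hp h hcard (fun i => z i.1) fun i => z i.1
  simp only [Fintype.sum_sigma, sum_const, card_univ, Fintype.card_fin, nsmul_eq_mul] at key
  set a : ι → ℝ := fun i => ((c i).toNat : ℝ) with ha
  set b : ι → ℝ := fun i => ((-c i).toNat : ℝ) with hb
  have hab : ∀ i, (c i : ℝ) = a i - b i := fun i => by
    simp only [ha, hb]
    have h := congrArg (Int.cast : ℤ → ℝ) (hsub i)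
    rw [Int.cast_sub] at h
    exact_mod_cast h.symm
  have hswap : ∑ i, ∑ j, a i * b j * dist (z i) (z j) ^ p =
      ∑ i, ∑ j, b i * a j * dist (z i) (z j) ^ p := by
    rw [sum_comm]
    refine sum_congr rfl fun i _ => sum_congr rfl fun j _ => ?_
    rw [dist_comm]
    ring
  have e : ∑ i, ∑ j, (c i : ℝ) * c j * dist (z i) (z j) ^ p =
      ∑ i, ∑ j, a i * a j * dist (z i) (z j) ^ p + ∑ i, ∑ j, b i * b j * dist (z i) (z j) ^ p -
      (∑ i, ∑ j, a i * b j * dist (z i) (z j) ^ p +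
        ∑ i, ∑ j, b i * a j * dist (z i) (z j) ^ p) := by
    simp only [← sum_add_distrib, ← sum_sub_distrib, hab]
    exact sum_congr rfl fun i _ => sum_congr rfl fun j _ => by ring
  simp only [mul_sum, ← mul_assoc] at key
  rw [e, ← hswap]
  simp only [mul_assoc, ← mul_sum] at key ⊢
  linarith

open Finset Filter Topology in
lemma isNegativeType_of_mem_grSet {X : Type*} [MetricSpace X] {p : ℝ} (hp : 0 < p)
    (h : p ∈ grSet (dist : X → X → ℝ)) {ι : Type*} [Fintype ι] (z : ι → X) :
    IsNegativeType fun i j => dist (z i) (z j) ^ p := by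
  classical
  intro c hc
  rcases isEmpty_or_nonempty ι with hι | ⟨⟨o⟩⟩
  · simp
  let a : ℕ → ι → ℤ := fun k i => ⌊c i * k⌋ - if i = o then ∑ j, ⌊c j * k⌋ else 0
  have ha : ∀ k, ∑ i, a k i = 0 := fun k => by simp [a]
  have hfloor : ∀ i, Tendsto (fun k : ℕ => (⌊c i * k⌋ : ℝ) / k) atTop (𝓝 (c i)) := fun i =>
    tendsto_floor_mul_div_atTop (c i)
  have hlim : ∀ i, Tendsto (fun k : ℕ => (a k i : ℝ) / k) atTop (𝓝 (c i)) := by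
    intro i
    have h1 := (hfloor i).sub (tendsto_finsetSum univ fun j _ => hfloor j |>.const_mul
      (if i = o then (1 : ℝ) else 0))
    rw [← mul_sum, hc, mul_zero, sub_zero] at h1
    refine h1.congr fun k => ?_
    by_cases hi : i = o <;> simp [a, hi, sub_div, sum_div]
  have hlim2 : Tendsto (fun k : ℕ => ∑ i, ∑ j, (a k i : ℝ) / k * (a k j / k) *
      dist (z i) (z j) ^ p) atTop (𝓝 (∑ i, ∑ j, c i * c j * dist (z i) (z j) ^ p)) :=
    tendsto_finsetSum _ fun i _ => tendsto_finsetSum _ fun j _ =>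
      ((hlim i).mul (hlim j)).mul_const _
  refine le_of_tendsto' hlim2 fun k => ?_
  have h2 := mul_nonpos_of_nonneg_of_nonpos (sq_nonneg ((k : ℝ)⁻¹))
    (roundness_int hp h z (a k) (ha k))
  refine Eq.trans_le ?_ h2
  simp only [mul_sum]
  exact sum_congr rfl fun i _ => sum_congr rfl fun j _ => by ring

open Finset in
lemma mem_grSet_of_isNegativeType {X : Type*} [MetricSpace X] {p : ℝ} (hp : 0 < p)
    (h : ∀ (n : ℕ) (z : Fin n ⊕ Fin n → X), IsNegativeType fun i j => dist (z i) (z j) ^ p) :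
    p ∈ grSet (dist : X → X → ℝ) := by
  refine ⟨hp.le, fun n _ x y => ?_⟩
  have h1 := h n (Sum.elim x y) (Sum.elim (fun _ => 1) fun _ => -1) (by simp)
  simp only [Fintype.sum_sum_type, Sum.elim_inl, Sum.elim_inr, sum_add_distrib] at h1
  have h2 := sum_lt_add_eq hp x y
  have h3 : ∑ i, ∑ j, dist (y i) (x j) ^ p = ∑ i, ∑ j, dist (x i) (y j) ^ p := by
    rw [sum_comm]
    simp only [dist_comm]
  simp only [mul_one, one_mul, mul_neg, neg_mul, sum_neg_distrib, neg_neg, h3] at h1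
  linarith

/-- The set of exponents satisfying the roundness inequality is downward closed. -/
lemma grSet_of_le {X : Type*} [MetricSpace X] {p q : ℝ} (hp : 0 < p) (hpq : p ≤ q)
    (hq : q ∈ grSet (dist : X → X → ℝ)) : p ∈ grSet (dist : X → X → ℝ) := by
  rcases hpq.eq_or_lt with rfl | hlt
  · exact hq
  have hq0 := hp.trans hlt
  refine mem_grSet_of_isNegativeType hp fun n z => ?_
  have h := (isNegativeType_of_mem_grSet hq0 hq z).rpow
    (fun i j => by rw [dist_comm]) (fun i j => by positivity)
    ⟨div_pos hp hq0, (div_lt_one hq0).2 hlt⟩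
  have e : ∀ i j, (dist (z i) (z j) ^ q) ^ (p / q) = dist (z i) (z j) ^ p := fun i j => by
    rw [← Real.rpow_mul dist_nonneg, mul_div_cancel₀ _ hq0.ne']
  simpa only [e] using h

/-- The roundness inequality holds for every exponent up to the generalized roundness. -/
lemma mem_grSet_of_le_genRoundness {X : Type*} [MetricSpace X] {p : ℝ} (hp : 0 ≤ p)
    (h : ENNReal.ofReal p ≤ genRoundness (dist : X → X → ℝ)) :
    p ∈ grSet (dist : X → X → ℝ) := by
  rcases hp.eq_or_lt with rfl | hp0
  · refine ⟨le_rfl, fun n _ x y => ?_⟩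
    have e : ∑ i : Fin n, ∑ j : Fin n, (if i < j then (1 : ℝ) + 1 else 0) =
        ∑ i : Fin n, ∑ j : Fin n, ((if i < j then (1 : ℝ) else 0) + if j < i then 1 else 0) := by
      simp only [Finset.sum_add_distrib]
      rw [Finset.sum_comm (f := fun i j : Fin n => if j < i then (1 : ℝ) else 0)]
      simp only [← Finset.sum_add_distrib, ← ite_add_zero]
    simp only [Real.rpow_zero, e]
    refine Finset.sum_le_sum fun i _ => Finset.sum_le_sum fun j _ => ?_
    split_ifs with h1 h2
    · exact absurd h2 h1.not_gt
    all_goals norm_num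
  have hlt : ∀ r, 0 < r → r < p → r ∈ grSet (dist : X → X → ℝ) := by
    intro r hr hrp
    have h1 : ENNReal.ofReal r < genRoundness (dist : X → X → ℝ) :=
      ((ENNReal.ofReal_lt_ofReal_iff hp0).2 hrp).trans_le h
    obtain ⟨_, ⟨q, hq, rfl⟩, hrq⟩ := lt_sSup_iff.1 h1
    exact grSet_of_le hr (ENNReal.lt_ofReal_iff_toReal_lt (by simp) |>.1 hrq |>.le |>
      fun h => by rwa [ENNReal.toReal_ofReal hr.le] at h) hq
  refine ⟨hp, fun n hn x y => ?_⟩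
  have hc : ∀ a : ℝ, ContinuousAt (fun r => a ^ r) p := fun a =>
    Real.continuousAt_const_rpow' hp0.ne'
  have hev : ∀ᶠ r in nhdsWithin p (Set.Iio p), r ∈ grSet (dist : X → X → ℝ) := by
    filter_upwards [Ioo_mem_nhdsLT hp0] with r hr using hlt r hr.1 hr.2
  refine le_of_tendsto_of_tendsto (b := nhdsWithin p (Set.Iio p))
    (f := fun r => ∑ i, ∑ j, if i < j then dist (x i) (x j) ^ r + dist (y i) (y j) ^ r else 0)
    (g := fun r => ∑ i, ∑ j, dist (x i) (y j) ^ r) ?_ ?_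
    (hev.mono fun r hr => hr.2 n hn x y)
  · refine tendsto_finsetSum _ fun i _ => tendsto_finsetSum _ fun j _ => ?_
    split_ifs
    · exact ((hc _).add (hc _)).tendsto.mono_left nhdsWithin_le_nhds
    · exact tendsto_const_nhds
  · exact tendsto_finsetSum _ fun i _ => tendsto_finsetSum _ fun j _ =>
      (hc _).tendsto.mono_left nhdsWithin_le_nhds

/-- `x` and `y` differ in exactly `k` coordinates, in each of them by `s` or `-s`. -/
def DiffersBy {I G : Type*} [Fintype I] [DecidableEq G] [AddCommGroup G]
    (s : G) (k : ℕ) (x y : I → G) : Prop :=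
  (∀ i, x i ≠ y i → x i - y i = s ∨ x i - y i = -s) ∧
    (Finset.univ.filter fun i => x i ≠ y i).card = k

/-- The permutations of `I → G` preserving all the relations `DiffersBy s k`. -/
def differsBySubgroup (I G : Type*) [Fintype I] [DecidableEq G] [AddCommGroup G] :
    Subgroup (Equiv.Perm (I → G)) where
  carrier := {h | ∀ (s : G) (k : ℕ) (x y : I → G), DiffersBy s k (h x) (h y) ↔ DiffersBy s k x y}
  mul_mem' := fun {a b} ha hb s k x y => by
    rw [Equiv.Perm.mul_apply, Equiv.Perm.mul_apply, ha, hb]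
  one_mem' := fun s k x y => by rfl
  inv_mem' := fun {a} ha s k x y => by
    rw [← ha s k]
    simp

section Homogeneous

variable {I G : Type*} [Fintype I] [Fintype G] [DecidableEq G] [AddCommGroup G]

open Finset in
lemma exists_mem_differsBySubgroup {s : G} {k : ℕ} {x y x' y' : I → G}
    (h : DiffersBy s k x y) (h' : DiffersBy s k x' y') :
    ∃ g ∈ differsBySubgroup I G, g x = x' ∧ g y = y' := by
  classical
  have hcard : Fintype.card {i // x' i ≠ y' i} = Fintype.card {i // x i ≠ y i} := by
    rw [Fintype.card_subtype, Fintype.card_subtype, h.2, h'.2]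
  let e := Fintype.equivOfCardEq hcard
  let σ : Equiv.Perm I := e.extendSubtype
  have hσ : ∀ i, x' i ≠ y' i → x (σ i) ≠ y (σ i) := fun i hi => e.extendSubtype_mem i hi
  have hσ' : ∀ i, ¬ x' i ≠ y' i → ¬ x (σ i) ≠ y (σ i) := fun i hi =>
    e.extendSubtype_not_mem i hi
  have hε : ∀ i, ∃ ε : ℤˣ, ε • (y (σ i) - x (σ i)) = y' i - x' i := by
    intro i
    by_cases hi : x' i = y' i
    · have := hσ' i (not_not.2 hi)
      rw [not_not] at this
      exact ⟨1, by simp [hi, this]⟩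
    · rw [← neg_sub (x (σ i)), ← neg_sub (x' i)]
      rcases h.1 _ (hσ i hi) with h1 | h1 <;> rcases h'.1 i hi with h2 | h2 <;> rw [h1, h2]
      · exact ⟨1, by simp⟩
      · exact ⟨-1, by simp⟩
      · exact ⟨-1, by simp⟩
      · exact ⟨1, by simp⟩
  choose ε hε using hε
  let f : (I → G) → I → G := fun z i => x' i + ε i • (z (σ i) - x (σ i))
  have hsub : ∀ u v i, f u i - f v i = ε i • (u (σ i) - v (σ i)) := fun u v i => by
    simp only [f, add_sub_add_left_eq_sub, ← smul_sub, sub_sub_sub_cancel_right]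
  have hne : ∀ u v i, f u i ≠ f v i ↔ u (σ i) ≠ v (σ i) := fun u v i => by
    rw [← sub_ne_zero, hsub, ne_eq, smul_eq_zero_iff_eq, ← ne_eq, sub_ne_zero]
  have hinj : Function.Injective f := fun u v huv => by
    ext i
    by_contra hi
    refine (hne u v (σ.symm i)).2 (by simpa using hi) ?_
    rw [huv]
  refine ⟨Equiv.ofBijective f (Finite.injective_iff_bijective.1 hinj), ?_, ?_, ?_⟩
  · intro s k u v
    simp only [Equiv.ofBijective_apply, DiffersBy, hne, hsub]
    refine and_congr ?_ ?_
    · rw [← σ.forall_congr_right (q := fun i => u i ≠ v i → u i - v i = s ∨ u i - v i = -s)]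
      refine forall_congr' fun i => imp_congr_right fun _ => ?_
      rcases Int.units_eq_one_or (ε i) with h | h <;> rw [h]
      · simp
      · simp only [Units.neg_smul, one_smul, neg_eq_iff_eq_neg, neg_neg]
        exact or_comm
    · rw [← card_map σ.toEmbedding (s := univ.filter fun i => u (σ i) ≠ v (σ i))]
      refine Eq.congr_left (congrArg card ?_)
      ext i
      simp only [mem_map_equiv, mem_filter, mem_univ, true_and, Equiv.apply_symm_apply]
  · ext i
    simp [f]
  · ext i
    simp [f, hε]

open Classical in
/-- The ordered pairs which differ in `k` coordinates by `±s`. -/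
noncomputable def diffPairs (I : Type*) {G : Type*} [Fintype I] [Fintype G] [DecidableEq G]
    [AddCommGroup G] (s : G) (k : ℕ) : Finset ((I → G) × (I → G)) :=
  Finset.univ.filter fun q => DiffersBy s k q.1 q.2

variable [DecidableEq I]

/-- The average of `F` over `diffPairs I s k`. -/
noncomputable def diffAverage (F : (I → G) → (I → G) → ℝ) (s : G) (k : ℕ) : ℝ :=
  ((diffPairs I s k).card : ℝ)⁻¹ * ∑ q ∈ diffPairs I s k, F q.1 q.2

open Finset in
open scoped Classical in
/-- Averaging over the symmetry group is the same as averaging over all pairs of a given type. -/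
lemma sum_differsBySubgroup (F : (I → G) → (I → G) → ℝ) {s : G} {k : ℕ} {x y : I → G}
    (h : DiffersBy s k x y) :
    ∑ g : differsBySubgroup I G, F (g.1 x) (g.1 y) =
      (Fintype.card (differsBySubgroup I G) : ℝ) * diffAverage F s k := by
  have hmem : ∀ q : (I → G) × (I → G), q ∈ diffPairs I s k ↔ DiffersBy s k q.1 q.2 := fun q => by
    simp [diffPairs]
  have h1 : ∀ q ∈ diffPairs I s k, ∑ g : differsBySubgroup I G, F (g.1 q.1) (g.1 q.2) =
      ∑ g : differsBySubgroup I G, F (g.1 x) (g.1 y) := by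
    intro q hq
    obtain ⟨k, hk, hx, hy⟩ := exists_mem_differsBySubgroup h ((hmem q).1 hq)
    refine Fintype.sum_equiv (Equiv.mulRight ⟨k, hk⟩) _ _ fun g => ?_
    rw [← hx, ← hy]
    rfl
  have h2 : ∀ g : differsBySubgroup I G, ∑ q ∈ diffPairs I s k, F (g.1 q.1) (g.1 q.2) =
      ∑ q ∈ diffPairs I s k, F q.1 q.2 := by
    intro g
    refine sum_equiv (Equiv.prodCongr g.1 g.1) (fun q => ?_) fun q _ => rfl
    rw [hmem, hmem]
    exact (g.2 s k q.1 q.2).symm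
  have h3 := sum_comm (s := diffPairs I s k) (t := (univ : Finset (differsBySubgroup I G)))
    (f := fun q g => F (g.1 q.1) (g.1 q.2))
  rw [sum_congr rfl h1, sum_congr rfl fun g _ => h2 g, sum_const, sum_const, nsmul_eq_mul,
    nsmul_eq_mul, card_univ] at h3
  have hpos : ((diffPairs I s k).card : ℝ) ≠ 0 := by
    exact_mod_cast (card_pos.2 ⟨(x, y), (hmem _).2 h⟩).ne'
  rw [diffAverage, mul_left_comm, ← h3, inv_mul_cancel_left₀ hpos]

end Homogeneous

open Finset in
lemma DiffersBy.extend {U I G : Type*} [Fintype U] [Fintype I] [DecidableEq G] [AddCommGroup G]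
    (φ : U ↪ I) {s : G} {k : ℕ} {x y : U → G} (h : DiffersBy s k x y) :
    DiffersBy s k (Function.extend φ x 0) (Function.extend φ y 0) := by
  have hout : ∀ i, (¬ ∃ u, φ u = i) → Function.extend φ x 0 i = Function.extend φ y 0 i :=
    fun i hi => by rw [Function.extend_apply' _ _ _ hi, Function.extend_apply' _ _ _ hi]
  constructor
  · intro i hi
    by_cases hu : ∃ u, φ u = i
    · obtain ⟨u, rfl⟩ := hu
      rw [φ.injective.extend_apply, φ.injective.extend_apply] at hi ⊢
      exact h.1 u hi
    · exact absurd (hout i hu) hi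
  · rw [← h.2, ← card_map φ]
    congr 1
    ext i
    simp only [mem_filter, mem_univ, true_and, mem_map]
    constructor
    · intro hi
      by_cases hu : ∃ u, φ u = i
      · obtain ⟨u, rfl⟩ := hu
        rw [φ.injective.extend_apply, φ.injective.extend_apply] at hi
        exact ⟨u, hi, rfl⟩
      · exact absurd (hout i hu) hi
    · rintro ⟨u, hu, rfl⟩
      rwa [φ.injective.extend_apply, φ.injective.extend_apply]

/-- The `i`-th vector of the configuration supported on the half `c` of the index set: it equals
`s` there, except for the sign flip on the `i`-th block. -/
def flipVector {G : Type*} [AddCommGroup G] {N b : ℕ} (s : G) (c : Bool) (i : Fin N) :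
    Fin N × Fin b × Bool → G :=
  fun u => if u.2.2 = c then (if u.1 = i then -s else s) else 0

open Finset in
lemma flipVector_differsBy_same {G : Type*} [DecidableEq G] [AddCommGroup G] {N b : ℕ} {s : G}
    (hs : s + s ≠ 0) (c : Bool) {i j : Fin N} (hij : i ≠ j) :
    DiffersBy (s + s) (2 * b) (flipVector (b := b) s c i) (flipVector s c j) := by
  have hne : s ≠ -s := fun h => hs (by nth_rewrite 1 [h]; simp)
  constructor
  · intro u hu
    unfold flipVector at hu ⊢
    split_ifs at hu ⊢ <;> simp_all [sub_eq_add_neg]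
  · have : (univ.filter fun u => flipVector (b := b) s c i u ≠ flipVector s c j u) =
        ({i, j} : Finset (Fin N)) ×ˢ (univ : Finset (Fin b)) ×ˢ ({c} : Finset Bool) := by
      ext u
      rw [mem_filter]
      simp only [mem_univ, true_and, mem_product, mem_insert, mem_singleton, flipVector]
      split_ifs <;> simp_all [hne.symm]
    rw [this, card_product, card_product, card_pair hij]
    simp

open Finset in
lemma flipVector_differsBy_opposite {G : Type*} [DecidableEq G] [AddCommGroup G] {N b : ℕ} {s : G}
    (hs : s ≠ 0) (i j : Fin N) :
    DiffersBy s (N * (2 * b)) (flipVector (b := b) s false i) (flipVector s true j) := by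
  constructor
  · intro u hu
    unfold flipVector at hu ⊢
    split_ifs at hu ⊢ <;> simp_all
  · have : (univ.filter fun u => flipVector (b := b) s false i u ≠ flipVector s true j u) =
        univ := by
      ext u
      rw [mem_filter]
      simp only [mem_univ, true_and, iff_true, flipVector]
      split_ifs <;> simp_all [hs.symm]
    rw [this]
    simp [mul_comm]

open Finset in
/-- A single averaging step: doubling the difference while dividing the number of coordinates
by `N` loses at most the factor `1 - 1 / N`. -/
lemma diffAverage_step {I G B : Type*} [Fintype I] [DecidableEq I] [Fintype G] [DecidableEq G]
    [AddCommGroup G] [MetricSpace B] {p : ℝ} (hp : p ∈ grSet (dist : B → B → ℝ))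
    (f : (I → G) → B) {N b : ℕ} (hN : 2 ≤ N) (hI : N * (2 * b) ≤ Fintype.card I) {s : G}
    (hs : s + s ≠ 0) :
    (1 - 1 / (N : ℝ)) * diffAverage (fun x y => dist (f x) (f y) ^ p) (s + s) (2 * b) ≤
      diffAverage (fun x y => dist (f x) (f y) ^ p) s (N * (2 * b)) := by
  classical
  have hs0 : s ≠ 0 := fun h => hs (by simp [h])
  obtain ⟨φ⟩ : Nonempty (Fin N × Fin b × Bool ↪ I) :=
    Function.Embedding.nonempty_of_card_le (by simpa [mul_comm] using hI)
  set F : (I → G) → (I → G) → ℝ := fun x y => dist (f x) (f y) ^ p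
  let X : Bool → Fin N → I → G := fun c i => Function.extend φ (flipVector s c i) 0
  have hX : ∀ c {i j}, i ≠ j → DiffersBy (s + s) (2 * b) (X c i) (X c j) := fun c i j hij =>
    (flipVector_differsBy_same hs c hij).extend φ
  have hXY : ∀ i j, DiffersBy s (N * (2 * b)) (X false i) (X true j) := fun i j =>
    (flipVector_differsBy_opposite hs0 i j).extend φ
  set H : ℝ := (Fintype.card (differsBySubgroup I G) : ℝ)
  have hH : 0 < H := by
    have : 0 < Fintype.card (differsBySubgroup I G) := Fintype.card_pos
    exact Nat.cast_pos.2 this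
  set a := diffAverage F (s + s) (2 * b)
  set a' := diffAverage F s (N * (2 * b))
  have key := sum_le_sum fun (g : differsBySubgroup I G) (_ : g ∈ univ) =>
    hp.2 N hN (fun i => f (g.1 (X false i))) fun i => f (g.1 (X true i))
  have hr : ∑ g : differsBySubgroup I G, ∑ i, ∑ j,
      dist (f (g.1 (X false i))) (f (g.1 (X true j))) ^ p = N * (N * (H * a')) := by
    rw [sum_comm]
    simp_rw [sum_comm (s := (univ : Finset (differsBySubgroup I G)))]
    rw [sum_congr rfl fun i _ => sum_congr rfl fun j _ => sum_differsBySubgroup F (hXY i j)]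
    simp only [sum_const, card_univ, Fintype.card_fin, nsmul_eq_mul]
    rfl
  have hl : ∑ g : differsBySubgroup I G, (∑ i, ∑ j, if i < j then
      dist (f (g.1 (X false i))) (f (g.1 (X false j))) ^ p +
      dist (f (g.1 (X true i))) (f (g.1 (X true j))) ^ p else 0) = N * (N - 1) * (H * a) := by
    have e1 : ∀ i j, ∑ g : differsBySubgroup I G, (if i < j then
        dist (f (g.1 (X false i))) (f (g.1 (X false j))) ^ p +
        dist (f (g.1 (X true i))) (f (g.1 (X true j))) ^ p else 0) =
        2 * if i < j then (if i = j then 0 else H * a) else 0 := by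
      intro i j
      by_cases hij : i < j
      · simp only [hij, hij.ne, if_true, if_false, sum_add_distrib, two_mul]
        exact congrArg₂ _ (sum_differsBySubgroup F (hX false hij.ne))
          (sum_differsBySubgroup F (hX true hij.ne))
      · simp [hij]
    rw [sum_comm]
    simp_rw [sum_comm (s := (univ : Finset (differsBySubgroup I G))), e1, ← mul_sum]
    rw [← sum_sum_eq_two_mul_sum_lt (fun i j : Fin N => if i = j then 0 else H * a)
      (fun i j => by simp only [eq_comm]) fun i => by simp]
    have e2 : ∀ i j : Fin N, (if i = j then 0 else H * a) = H * a - if i = j then H * a else 0 :=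
      fun i j => by split_ifs <;> simp
    simp only [e2, sum_sub_distrib]
    simp
    ring
  rw [hl, hr] at key
  have hN0 : (0 : ℝ) < N := by exact_mod_cast (by omega : 0 < N)
  have h1 : (N : ℝ) * H * ((N - 1) * a) ≤ N * H * (N * a') := by linarith
  have h2 := le_of_mul_le_mul_left h1 (by positivity)
  have h3 : (1 - 1 / (N : ℝ)) * a = (N - 1) * a / N := by field_simp
  rw [h3, div_le_iff₀ hN0]
  linarith

/-- The parametrization of `Ln N` by residues modulo `N ^ (2 * N)`. -/
noncomputable def gridPoint (N : ℕ) (a : ZMod (N ^ (2 * N))) : ℝ :=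
  ((a.val : ℝ) + 1) / (N : ℝ) ^ N

section Grid

variable {N : ℕ} [NeZero N]

lemma gridPoint_injective : Function.Injective (gridPoint N) := by
  intro a b hab
  have hN : ((N : ℝ) ^ N) ≠ 0 := pow_ne_zero _ (NeZero.ne _)
  rw [gridPoint, gridPoint, div_left_inj' hN, add_left_inj, Nat.cast_inj] at hab
  exact ZMod.val_injective _ hab

lemma range_gridPoint : Set.range (gridPoint N) = Ln N := by
  ext a
  constructor
  · rintro ⟨b, rfl⟩
    exact ⟨b.val + 1, by omega, b.val_lt, by rw [gridPoint]; push_cast; rfl⟩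
  · rintro ⟨k, hk1, hk2, rfl⟩
    refine ⟨((k - 1 : ℕ) : ZMod (N ^ (2 * N))), ?_⟩
    rw [gridPoint, ZMod.val_natCast_of_lt (by omega), Nat.cast_sub hk1]
    simp

lemma cyclicDist_gridPoint {t : ℤ} {s : ℕ} (hs : (s : ℝ) = 2 ^ t * (N : ℝ) ^ N)
    (hs2 : 2 * s ≤ N ^ (2 * N)) (a b : ZMod (N ^ (2 * N))) :
    cyclicDist N (gridPoint N a) (gridPoint N b) = 2 ^ t ↔ a - b = s ∨ a - b = -s := by
  have hN : (0 : ℝ) < (N : ℝ) ^ N := pow_pos (Nat.cast_pos.2 (NeZero.pos N)) _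
  have ha := a.val_lt
  have hb := b.val_lt
  have hK : 0 < N ^ (2 * N) := pow_pos (NeZero.pos N) _
  have hKr : ((N ^ (2 * N) : ℕ) : ℝ) = (N : ℝ) ^ N * (N : ℝ) ^ N := by
    push_cast
    rw [two_mul, pow_add]
  have hab : a - b = (((a.val : ℤ) - b.val : ℤ) : ZMod (N ^ (2 * N))) := by simp
  rw [hab, gridPoint, gridPoint]
  clear hab
  generalize a.val = α at *
  generalize b.val = β at *
  clear a b
  set K := N ^ (2 * N) with hKdef
  have hsr : (2 : ℝ) ^ t = s / (N : ℝ) ^ N := by rw [hs]; field_simp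
  have h1 : |((α : ℝ) + 1) / (N : ℝ) ^ N - ((β : ℝ) + 1) / (N : ℝ) ^ N| =
      ((|(α : ℤ) - β| : ℤ) : ℝ) / (N : ℝ) ^ N := by
    rw [← sub_div, abs_div, abs_of_pos hN]
    push_cast
    rw [add_sub_add_right_eq_sub]
  have h2 : (N : ℝ) ^ N - ((|(α : ℤ) - β| : ℤ) : ℝ) / (N : ℝ) ^ N =
      (((K : ℤ) - |(α : ℤ) - β| : ℤ) : ℝ) / (N : ℝ) ^ N := by
    rw [Int.cast_sub, Int.cast_natCast, hKr]
    field_simp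
  have h3 : cyclicDist N (((α : ℝ) + 1) / (N : ℝ) ^ N) (((β : ℝ) + 1) / (N : ℝ) ^ N) = 2 ^ t ↔
      min |(α : ℤ) - β| (K - |(α : ℤ) - β|) = s := by
    rw [cyclicDist, h1, h2, hsr, min_div_div_right hN.le, div_left_inj' hN.ne']
    exact_mod_cast Iff.rfl
  have h4 : ∀ z : ℤ, (((α : ℤ) - β : ℤ) : ZMod K) = (z : ℤ) ↔ (K : ℤ) ∣ ((α : ℤ) - β - z) := by
    intro z
    rw [← sub_eq_zero, ← Int.cast_sub, ZMod.intCast_zmod_eq_zero_iff_dvd]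
  have h5 := h4 s
  have h6 := h4 (-s)
  rw [Int.cast_natCast] at h5
  rw [Int.cast_neg, Int.cast_natCast] at h6
  rw [h3, h5, h6]
  constructor
  · intro h
    have : (α : ℤ) - β = s ∨ (α : ℤ) - β = -s ∨ (α : ℤ) - β = K - s ∨ (α : ℤ) - β = s - K := by
      rcases abs_cases ((α : ℤ) - β) with h7 | h7 <;> omega
    rcases this with h | h | h | h
    · exact Or.inl ⟨0, by omega⟩
    · exact Or.inr ⟨0, by omega⟩
    · exact Or.inr ⟨1, by omega⟩
    · exact Or.inl ⟨-1, by omega⟩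
  · have hK' : (0 : ℤ) < K := by exact_mod_cast hK
    rintro (⟨c, hc⟩ | ⟨c, hc⟩)
    · have h7 : c < 1 := by nlinarith
      have h8 : -2 < c := by nlinarith
      have : c = 0 ∨ c = -1 := by omega
      rcases this with rfl | rfl <;> rcases abs_cases ((α : ℤ) - β) with h7 | h7 <;> omega
    · have h7 : c < 2 := by nlinarith
      have h8 : -1 < c := by nlinarith
      have : c = 0 ∨ c = 1 := by omega
      rcases this with rfl | rfl <;> rcases abs_cases ((α : ℤ) - β) with h7 | h7 <;> omega

/-- Coordinatewise `gridPoint`. -/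
noncomputable def gridVector {I : Type*} (x : I → ZMod (N ^ (2 * N))) : I → ℝ :=
  fun i => gridPoint N (x i)

lemma gridVector_injective {I : Type*} :
    Function.Injective (gridVector (N := N) (I := I)) :=
  fun _ _ h => funext fun i => gridPoint_injective (congrFun h i)

lemma pairSet_eq_image {t : ℤ} {m s : ℕ} (hs : (s : ℝ) = 2 ^ t * (N : ℝ) ^ N)
    (hs2 : 2 * s ≤ N ^ (2 * N)) :
    pairSet N t m = Prod.map gridVector gridVector ''
      (diffPairs (Fin (N ^ N)) (s : ZMod (N ^ (2 * N))) (N ^ m) :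
        Set ((Fin (N ^ N) → ZMod (N ^ (2 * N))) × (Fin (N ^ N) → ZMod (N ^ (2 * N))))) := by
  have hmem : ∀ x : Fin (N ^ N) → ZMod (N ^ (2 * N)), gridVector x ∈ Mn N := fun x i => by
    rw [← range_gridPoint]
    exact ⟨x i, rfl⟩
  have hsurj : ∀ x ∈ Mn N, ∃ a : Fin (N ^ N) → ZMod (N ^ (2 * N)), gridVector a = x := by
    intro x hx
    have : ∀ i, ∃ a, gridPoint N a = x i := fun i => by
      have := hx i
      rwa [← range_gridPoint] at this
    choose a ha using this
    exact ⟨a, funext ha⟩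
  have hiff : ∀ x y : Fin (N ^ N) → ZMod (N ^ (2 * N)),
      IsPair N t m (gridVector x) (gridVector y) ↔
        DiffersBy (s : ZMod (N ^ (2 * N))) (N ^ m) x y := by
    intro x y
    simp only [IsPair, hmem, true_and, DiffersBy, gridVector, gridPoint_injective.ne_iff,
      cyclicDist_gridPoint hs hs2]
    rw [← Set.ncard_coe_finset]
    simp
  ext ⟨x, y⟩
  constructor
  · intro h
    obtain ⟨a, rfl⟩ := hsurj x h.1
    obtain ⟨b, rfl⟩ := hsurj y h.2.1
    exact ⟨(a, b), by simpa [diffPairs] using (hiff a b).1 h, rfl⟩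
  · rintro ⟨⟨a, b⟩, h, hab⟩
    obtain ⟨rfl, rfl⟩ := Prod.mk.inj hab
    exact (hiff a b).2 (by simpa [diffPairs] using h)

/-- The averages over `pairSet` are averages over pairs of vectors with entries in a finite
cyclic group. -/
lemma pairSet_average_eq {t : ℤ} {m s : ℕ} (hs : (s : ℝ) = 2 ^ t * (N : ℝ) ^ N)
    (hs2 : 2 * s ≤ N ^ (2 * N)) (F : (Fin (N ^ N) → ℝ) → (Fin (N ^ N) → ℝ) → ℝ) :
    (pairCount N t m : ℝ)⁻¹ * ∑ᶠ q ∈ pairSet N t m, F q.1 q.2 =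
      diffAverage (fun x y => F (gridVector x) (gridVector y)) (s : ZMod (N ^ (2 * N)))
        (N ^ m) := by
  have hinj : Function.Injective (Prod.map gridVector gridVector :
      (Fin (N ^ N) → ZMod (N ^ (2 * N))) × (Fin (N ^ N) → ZMod (N ^ (2 * N))) → _) :=
    gridVector_injective.prodMap gridVector_injective
  rw [pairCount, pairSet_eq_image hs hs2, Set.ncard_image_of_injective _ hinj,
    finsum_mem_image hinj.injOn, Set.ncard_coe_finset, finsum_mem_coe_finset]
  rfl

end Grid

/-- Theorem 1 of the paper: let `n` be a positive even integer, `B` a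
metric space, `f : M_{n+2} → B` any function, `0 ≤ p` with `p ≤ 𝔮(B)` (which, for
`𝔮(B) = ∞`, is no restriction on `p ≥ 0`), and `−n ≤ t ≤ 0`.  Then
`(1/N_{(t,n+1)})·Σ_{{x,y}∈Θ_t^{n+1}} d(f x, f y)^p ≥
  (1−1/(n+2))^n·(1/N_{(t+n,1)})·Σ_{{u,v}∈Θ_{t+n}^1} d(f u, f v)^p`. -/
theorem averaging_inequality (n : ℕ) (hn : 0 < n) (hne : Even n)
    {B : Type*} [MetricSpace B] (f : (Fin ((n + 2) ^ (n + 2)) → ℝ) → B)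
    (p : ℝ) (hp : 0 ≤ p) (hpB : ENNReal.ofReal p ≤ genRoundness (dist : B → B → ℝ))
    (t : ℤ) (ht1 : -(n : ℤ) ≤ t) (ht2 : t ≤ 0) :
    (pairCount (n + 2) t (n + 1) : ℝ)⁻¹ *
        (∑ᶠ q ∈ pairSet (n + 2) t (n + 1), dist (f q.1) (f q.2) ^ p) ≥
      (1 - 1 / ((n : ℝ) + 2)) ^ n *
        ((pairCount (n + 2) (t + (n : ℤ)) 1 : ℝ)⁻¹ *
          ∑ᶠ q ∈ pairSet (n + 2) (t + (n : ℤ)) 1, dist (f q.1) (f q.2) ^ p) := by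
  have hgr := mem_grSet_of_le_genRoundness hp hpB
  obtain ⟨c, hc⟩ := hne
  obtain ⟨j, hj⟩ : ∃ j : ℕ, t = -j := ⟨(-t).toNat, by omega⟩
  have hjn : j ≤ n := by omega
  generalize hN : n + 2 = N at f ⊢
  have : NeZero N := ⟨by omega⟩
  have hNc : N = 2 * (c + 1) := by omega
  have hNr : (n : ℝ) + 2 = N := by exact_mod_cast hN
  let s : ℕ := 2 ^ (N - j) * (c + 1) ^ N
  have hs : (s : ℝ) = 2 ^ t * (N : ℝ) ^ N := by
    have h1 : (N : ℝ) ^ N = 2 ^ N * ((c : ℝ) + 1) ^ N := by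
      rw [← mul_pow]
      congr 1
      exact_mod_cast hNc
    rw [h1, hj, zpow_neg, zpow_natCast, ← mul_assoc]
    have h2 : (2 : ℝ) ^ N = 2 ^ j * 2 ^ (N - j) := by rw [← pow_add]; congr 1; omega
    rw [h2, inv_mul_cancel_left₀ (by positivity)]
    simp [s]
  have hs0 : 0 < s := by positivity
  have hsN : s ≤ N ^ N := by
    have h1 : N ^ N = 2 ^ N * (c + 1) ^ N := by rw [← mul_pow, ← hNc]
    rw [h1]
    exact Nat.mul_le_mul_right _ (Nat.pow_le_pow_right two_pos (by omega))
  have hbound : ∀ i ≤ n, 2 * (2 ^ i * s) ≤ N ^ (2 * N) := by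
    intro i hi
    rw [two_mul N, pow_add, ← mul_assoc, ← pow_succ']
    refine Nat.mul_le_mul ?_ hsN
    exact (Nat.pow_le_pow_right two_pos (by omega)).trans
      (Nat.pow_le_pow_left (by omega : 2 ≤ N) N)
  have hcast : ∀ i : ℕ, ((2 ^ i * s : ℕ) : ℝ) = 2 ^ (t + i) * (N : ℝ) ^ N := by
    intro i
    rw [Nat.cast_mul, hs, zpow_add₀ two_ne_zero, zpow_natCast]
    push_cast
    ring
  let A : ℕ → ℝ := fun i => diffAverage (I := Fin (N ^ N))
    (fun x y => dist (f (gridVector x)) (f (gridVector y)) ^ p)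
    ((2 ^ i * s : ℕ) : ZMod (N ^ (2 * N))) (N ^ (n + 1 - i))
  have havg : ∀ i ≤ n, (pairCount N (t + i) (n + 1 - i) : ℝ)⁻¹ *
      ∑ᶠ q ∈ pairSet N (t + i) (n + 1 - i), dist (f q.1) (f q.2) ^ p = A i := fun i hi =>
    pairSet_average_eq (hcast i) (hbound i hi) fun x y => dist (f x) (f y) ^ p
  have hstep : ∀ i < n, (1 - 1 / (N : ℝ)) * A (i + 1) ≤ A i := by
    intro i hi
    have hexp : n + 1 - i = (n - i - 1) + 1 + 1 := by omega
    have hexp' : n + 1 - (i + 1) = (n - i - 1) + 1 := by omega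
    have hpow : N ^ ((n - i - 1) + 1) = 2 * ((c + 1) * N ^ (n - i - 1)) := by
      rw [pow_succ', ← mul_assoc, ← hNc]
    have hdouble : ((2 ^ (i + 1) * s : ℕ) : ZMod (N ^ (2 * N))) =
        ((2 ^ i * s : ℕ) : ZMod (N ^ (2 * N))) + ((2 ^ i * s : ℕ) : ZMod (N ^ (2 * N))) := by
      rw [← Nat.cast_add]
      congr 1
      ring
    simp only [A]
    rw [hexp, hexp', pow_succ' N (n - i - 1 + 1), hpow, hdouble]
    refine diffAverage_step hgr (fun x => f (gridVector x)) (by omega) ?_ ?_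
    · rw [← hpow, ← pow_succ', Fintype.card_fin]
      exact Nat.pow_le_pow_right (by omega) (by omega)
    · rw [← hdouble, ne_eq, ZMod.natCast_eq_zero_iff]
      have h1 : 0 < 2 ^ (i + 1) * s := by positivity
      have h2 := hbound (i + 1) hi
      exact Nat.not_dvd_of_pos_of_lt h1 (by omega)
  have hfac : 0 ≤ 1 - 1 / (N : ℝ) := by
    rw [sub_nonneg, div_le_one (Nat.cast_pos.2 (NeZero.pos N))]
    exact_mod_cast (by omega : 1 ≤ N)
  have hall : ∀ i ≤ n, (1 - 1 / (N : ℝ)) ^ i * A i ≤ A 0 := by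
    intro i
    induction i with
    | zero => simp
    | succ i ih =>
      intro hi
      refine le_trans ?_ (ih (by omega))
      rw [pow_succ, mul_assoc]
      exact mul_le_mul_of_nonneg_left (hstep i hi) (pow_nonneg hfac i)
  have h0 := havg 0 (Nat.zero_le n)
  have hn' := havg n le_rfl
  rw [Nat.cast_zero, add_zero, Nat.sub_zero] at h0
  rw [Nat.add_sub_cancel_left] at hn'
  rw [hNr, h0, hn']
  exact hall n le_rfl
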